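/- arXiv:1704.02695 — 2 statements merged into one kernel-verified Lean document; each statement's English description precedes it below -/
import Mathlib

section
/- Let p, q, a, b ∈ ℂ with p ≠ 0, q ≠ 0, a ≠ 0; assume p^j ≠ 1 for every nonzero integer j, b ≠ a·p^m for every integer m, and 1 − a·p^n·q^k ≠ 0 and 1 − b·p^{−n}·q^k ≠ 0 for all integers n, k. For integers k ≤ n define F(n,k) = (−1)^{n−k} · p^{−(n−k)k} · (a p^k q^k; q)_{n−k} · (b p^{−k} q^k; q)_{n−k} / [ (p; p)_{n−k} · (b p^{−n−k}/a; p)_{n−k} ] and G(n,k) = p^{−n(n−1)/2 + k(k−1)/2} · (1 − a p^k q^k)(1 − b p^{−k} q^k) · (a p^n q^k; q)_{n−k} · (b q^k p^{−n}; q)_{n−k} / [ (1 − a p^n q^k)(1 − b p^{−n} q^k) · (p; p)_{n−k} · (b p^{1−2n}/a; p)_{n−k} ]. Then for all integers k ≤ n, ∑_{i=k}^{n} F(n,i)·G(i,k) equals 1 if n = k and equals 0 if n > k. -/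
/-- Finite q-shifted factorial `(z; t)_m = ∏_{i=0}^{m-1} (1 - z t^i)`. -/
noncomputable def qPoch (z t : ℂ) (m : ℕ) : ℂ :=
  ∏ i ∈ Finset.range m, (1 - z * t ^ i)

lemma qPoch_Ico (z t : ℂ) (i n : ℤ) :
    qPoch z t (n - i).toNat = ∏ j ∈ Finset.Ico i n, (1 - z * t ^ (j - i)) := by
  rw [Int.Ico_eq_finset_map, Finset.prod_map, qPoch]
  refine Finset.prod_congr rfl fun j _ => ?_
  simp

lemma qPoch_Ioc (z t : ℂ) (i n : ℤ) :
    qPoch z t (n - i).toNat = ∏ j ∈ Finset.Ioc i n, (1 - z * t ^ (j - i - 1)) := by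
  rw [Int.Ioc_eq_finset_map, Finset.prod_map, qPoch]
  refine Finset.prod_congr rfl fun j _ => ?_
  have : (i + 1 + (j : ℤ)) - i - 1 = j := by ring
  simp [this]

lemma qPoch_Ioc_rev (z t : ℂ) (i n : ℤ) :
    qPoch z t (n - i).toNat = ∏ j ∈ Finset.Ioc i n, (1 - z * t ^ (n - j)) := by
  rw [Int.Ioc_eq_finset_map, Finset.prod_map, qPoch, ← Finset.prod_range_reflect]
  refine Finset.prod_congr rfl fun j hj => ?_
  have hj := Finset.mem_range.mp hj
  have : n - (i + 1 + (j : ℤ)) = (((n - i).toNat - 1 - j : ℕ) : ℤ) := by omega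
  simp [this]

lemma qPoch_Ico_rev (z t : ℂ) (i n : ℤ) :
    qPoch z t (n - i).toNat = ∏ j ∈ Finset.Ico i n, (1 - z * t ^ (n - 1 - j)) := by
  rw [Int.Ico_eq_finset_map, Finset.prod_map, qPoch, ← Finset.prod_range_reflect]
  refine Finset.prod_congr rfl fun j hj => ?_
  have hj := Finset.mem_range.mp hj
  have : n - 1 - (i + (j : ℤ)) = (((n - i).toNat - 1 - j : ℕ) : ℤ) := by omega
  simp [this]

lemma prod_zpow_Ico (p : ℂ) (hp : p ≠ 0) (k i : ℤ) (h : k ≤ i) :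
    ∏ j ∈ Finset.Ico k i, p ^ j = p ^ (i * (i - 1) / 2 - k * (k - 1) / 2) := by
  induction i, h using Int.leInduction with
  | base => simp
  | succ m hm ih =>
    have : Finset.Ico k (m + 1) = insert m (Finset.Ico k m) := by
      ext x; simp; omega
    rw [this, Finset.prod_insert (by simp), ih, ← zpow_add₀ hp]
    congr 1
    have : (m + 1) * (m + 1 - 1) = m * (m - 1) + m * 2 := by ring
    rw [this, Int.add_mul_ediv_right _ _ (by norm_num)]
    ring

lemma node_sub (p a b : ℂ) (hp : p ≠ 0) (ha : a ≠ 0) (i j : ℤ) :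
    (a * p ^ i + b * p ^ (-i)) - (a * p ^ j + b * p ^ (-j)) =
      a * p ^ i * ((1 - p ^ (j - i)) * (1 - b / a * p ^ (-i - j))) := by
  have e : p ^ (-i - j) = p ^ (-i) * p ^ (-j) := by rw [← zpow_add₀ hp]; rfl
  rw [e, zpow_sub₀ hp, zpow_neg, zpow_neg]
  have := zpow_ne_zero i hp
  have := zpow_ne_zero j hp
  field_simp
  ring

lemma prod_node_Ioc (p a b : ℂ) (hp : p ≠ 0) (ha : a ≠ 0) (i n : ℤ) (h : i ≤ n) :
    ∏ j ∈ Finset.Ioc i n, ((a * p ^ i + b * p ^ (-i)) - (a * p ^ j + b * p ^ (-j))) =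
      a ^ (n - i) * p ^ ((n - i) * i) *
        (qPoch p p (n - i).toNat * qPoch (b * p ^ (-n - i) / a) p (n - i).toNat) := by
  rw [qPoch_Ioc p, qPoch_Ioc_rev, ← Finset.prod_mul_distrib]
  simp_rw [node_sub p a b hp ha]
  rw [Finset.prod_mul_distrib, Finset.prod_const]
  congr 1
  · rw [Int.card_Ioc, mul_pow, mul_comm (n - i) i, zpow_mul, ← zpow_natCast, ← zpow_natCast,
      Int.toNat_of_nonneg (by omega)]
  · refine Finset.prod_congr rfl fun j _ => ?_
    have e1 : p ^ (j - i) = p * p ^ (j - i - 1) := by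
      rw [← zpow_one_add₀ hp]; congr 1; ring
    have e2 : p ^ (-i - j) = p ^ (-n - i) * p ^ (n - j) := by
      rw [← zpow_add₀ hp]; congr 1; ring
    rw [e1, e2]; ring

lemma prod_node_Ico (p a b : ℂ) (hp : p ≠ 0) (ha : a ≠ 0) (k i : ℤ) (h : k ≤ i) :
    ∏ j ∈ Finset.Ico k i, ((a * p ^ i + b * p ^ (-i)) - (a * p ^ j + b * p ^ (-j))) =
      (-a) ^ (i - k) * p ^ (i * (i - 1) / 2 - k * (k - 1) / 2) *
        (qPoch p p (i - k).toNat * qPoch (b * p ^ (1 - 2 * i) / a) p (i - k).toNat) := by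
  rw [qPoch_Ico_rev p, qPoch_Ico_rev, ← Finset.prod_mul_distrib, ← prod_zpow_Ico p hp k i h]
  have : (-a) ^ (i - k) = ∏ j ∈ Finset.Ico k i, (-a) := by
    rw [Finset.prod_const, Int.card_Ico, ← zpow_natCast, Int.toNat_of_nonneg (by omega)]
  rw [this, ← Finset.prod_mul_distrib, ← Finset.prod_mul_distrib]
  refine Finset.prod_congr rfl fun j _ => ?_
  rw [← neg_sub, node_sub p a b hp ha]
  have e1 : p ^ (i - j) = p * p ^ (i - 1 - j) := by
    rw [← zpow_one_add₀ hp]; congr 1; ring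
  have e2 : p ^ (-j - i) = p ^ (1 - 2 * i) * p ^ (i - 1 - j) := by
    rw [← zpow_add₀ hp]; congr 1; ring
  rw [e1, e2]; ring

open Polynomial in
/-- The polynomial whose divided difference gives the off-diagonal entries. -/
noncomputable def gasperPoly (q a b : ℂ) (k n : ℤ) : ℂ[X] :=
  ∏ j ∈ Finset.Ioo k n, (C (-(q ^ j)) * X + C (1 + a * b * q ^ j * q ^ j))

lemma gasperPoly_natDegree (q a b : ℂ) (k n : ℤ) :
    (gasperPoly q a b k n).natDegree ≤ (n - k - 1).toNat := by
  unfold gasperPoly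
  refine (Polynomial.natDegree_prod_le _ _).trans ?_
  refine (Finset.sum_le_card_nsmul _ _ 1 fun j _ => Polynomial.natDegree_linear_le).trans ?_
  simp

lemma gasperPoly_eval (p q a b : ℂ) (hp : p ≠ 0) (k n i : ℤ) :
    (gasperPoly q a b k n).eval (a * p ^ i + b * p ^ (-i)) =
      ∏ j ∈ Finset.Ioo k n, ((1 - a * p ^ i * q ^ j) * (1 - b * p ^ (-i) * q ^ j)) := by
  unfold gasperPoly
  rw [Polynomial.eval_prod]
  refine Finset.prod_congr rfl fun j _ => ?_
  have := zpow_ne_zero i hp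
  simp only [Polynomial.eval_add, Polynomial.eval_mul, Polynomial.eval_C, Polynomial.eval_X]
  rw [zpow_neg]
  field_simp
  ring

lemma numer_eq (p q a b : ℂ) (hq : q ≠ 0) (k n i : ℤ) (hk : k < n) (hi : k ≤ i) (hn : i ≤ n) :
    (qPoch (a * p ^ i * q ^ i) q (n - i).toNat * qPoch (b * p ^ (-i) * q ^ i) q (n - i).toNat) *
    (qPoch (a * p ^ i * q ^ k) q (i - k).toNat * qPoch (b * q ^ k * p ^ (-i)) q (i - k).toNat) =
    ((1 - a * p ^ i * q ^ k) * (1 - b * p ^ (-i) * q ^ k)) *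
      ∏ j ∈ Finset.Ioo k n, ((1 - a * p ^ i * q ^ j) * (1 - b * p ^ (-i) * q ^ j)) := by
  have h3 : Finset.Ico k n = insert k (Finset.Ioo k n) := by ext x; simp; omega
  have h4 : Finset.Ico k n = Finset.Ico k i ∪ Finset.Ico i n := by ext x; simp; omega
  have h5 : Disjoint (Finset.Ico k i) (Finset.Ico i n) := by
    rw [Finset.disjoint_left]; intro x; simp; omega
  rw [← Finset.prod_insert (f := fun j : ℤ =>
    ((1 - a * p ^ i * q ^ j) * (1 - b * p ^ (-i) * q ^ j))) (by simp), ← h3, h4,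
    Finset.prod_union h5, qPoch_Ico, qPoch_Ico, qPoch_Ico, qPoch_Ico,
    ← Finset.prod_mul_distrib, ← Finset.prod_mul_distrib, mul_comm]
  congr 1 <;> refine Finset.prod_congr rfl fun j _ => ?_
  · have e : q ^ j = q ^ k * q ^ (j - k) := by rw [← zpow_add₀ hq]; congr 1; ring
    rw [e]; ring
  · have e : q ^ j = q ^ i * q ^ (j - i) := by rw [← zpow_add₀ hq]; congr 1; ring
    rw [e]; ring

/-- Gasper's bibasic matrix inversion (Example 4.1 of Wang–Ma). -/
theorem gasper_matrix_inversion
    (p q a b : ℂ)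
    (hp : p ≠ 0) (hq : q ≠ 0) (ha : a ≠ 0)
    (hp1 : ∀ j : ℤ, j ≠ 0 → p ^ j ≠ 1)
    (hab : ∀ m : ℤ, b ≠ a * p ^ m)
    (h1 : ∀ n k : ℤ, 1 - a * p ^ n * q ^ k ≠ 0)
    (h2 : ∀ n k : ℤ, 1 - b * p ^ (-n) * q ^ k ≠ 0) :
    ∀ k n : ℤ, k ≤ n →
      (∑ i ∈ Finset.Icc k n,
        -- F(n,i)
        ((-1 : ℂ) ^ (n - i) * p ^ (-(n - i) * i) *
          (qPoch (a * p ^ i * q ^ i) q (n - i).toNat *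
            qPoch (b * p ^ (-i) * q ^ i) q (n - i).toNat) /
          (qPoch p p (n - i).toNat * qPoch (b * p ^ (-n - i) / a) p (n - i).toNat)) *
        -- G(i,k)
        (p ^ (-(i * (i - 1) / 2) + k * (k - 1) / 2) *
          ((1 - a * p ^ k * q ^ k) * (1 - b * p ^ (-k) * q ^ k) *
            (qPoch (a * p ^ i * q ^ k) q (i - k).toNat *
              qPoch (b * q ^ k * p ^ (-i)) q (i - k).toNat)) /
          ((1 - a * p ^ i * q ^ k) * (1 - b * p ^ (-i) * q ^ k) *
            (qPoch p p (i - k).toNat * qPoch (b * p ^ (1 - 2 * i) / a) p (i - k).toNat)))) =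
      if n = k then 1 else 0 := by
  intro k n hkn
  rcases hkn.eq_or_lt with rfl | hlt
  · have e1 := h1 k k
    have e2 := h2 k k
    simp only [Finset.Icc_self, Finset.sum_singleton, sub_self, qPoch, Int.toNat_zero,
      Finset.range_zero, Finset.prod_empty, neg_add_cancel, neg_zero, zero_mul, zpow_zero,
      mul_one, one_mul, div_one, if_true]
    exact div_self (mul_ne_zero e1 e2)
  rw [if_neg (by omega)]
  set x : ℤ → ℂ := fun i => a * p ^ i + b * p ^ (-i) with hx
  have hne : ∀ i j, i ≠ j → x i - x j ≠ 0 := by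
    intro i j hij
    simp only [hx]
    rw [node_sub p a b hp ha]
    refine mul_ne_zero (mul_ne_zero ha (zpow_ne_zero _ hp)) (mul_ne_zero ?_ ?_)
    · exact sub_ne_zero.mpr (hp1 _ (by omega)).symm
    · intro h
      apply hab (i + j)
      have e : p ^ (-i - j) = (p ^ (i + j))⁻¹ := by rw [← zpow_neg]; congr 1; ring
      have := zpow_ne_zero (i + j) hp
      rw [e] at h
      field_simp at h
      linear_combination -h
  have hinj : Set.InjOn x (Finset.Icc k n : Finset ℤ) := by
    intro i _ j _ h
    by_contra hij
    exact hne i j hij (sub_eq_zero.mpr h)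
  have hdeg := gasperPoly_natDegree q a b k n
  have hcard : (Finset.Icc k n).card = (n + 1 - k).toNat := by simp
  have key := Lagrange.coeff_eq_sum hinj (P := gasperPoly q a b k n)
    (lt_of_le_of_lt Polynomial.degree_le_natDegree (by
      rw [hcard]; exact_mod_cast (by omega)))
  rw [Polynomial.coeff_eq_zero_of_natDegree_lt (by rw [hcard]; omega)] at key
  rw [← mul_zero ((-a) ^ (n - k) * ((1 - a * p ^ k * q ^ k) * (1 - b * p ^ (-k) * q ^ k))),
    key, Finset.mul_sum]
  refine Finset.sum_congr rfl fun i hi => ?_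
  obtain ⟨hi1, hi2⟩ := Finset.mem_Icc.mp hi
  have hsplit : (Finset.Icc k n).erase i = Finset.Ico k i ∪ Finset.Ioc i n := by
    ext y; simp; omega
  have hdisj : Disjoint (Finset.Ico k i) (Finset.Ioc i n) := by
    rw [Finset.disjoint_left]; intro y; simp; omega
  have hA := prod_node_Ioc p a b hp ha i n hi2
  have hB := prod_node_Ico p a b hp ha k i hi1
  have hA0 : ∏ j ∈ Finset.Ioc i n, (x i - x j) ≠ 0 :=
    Finset.prod_ne_zero_iff.mpr fun j hj => hne _ _ (by simp at hj; omega)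
  have hB0 : ∏ j ∈ Finset.Ico k i, (x i - x j) ≠ 0 :=
    Finset.prod_ne_zero_iff.mpr fun j hj => hne _ _ (by simp at hj; omega)
  have hN := numer_eq p q a b hq k n i hlt hi1 hi2
  have hev := gasperPoly_eval p q a b hp k n i
  rw [← hev] at hN
  rw [hsplit, Finset.prod_union hdisj]
  change _ = _ * (Polynomial.eval (a * p ^ i + b * p ^ (-i)) _ / _)
  simp only [hx] at hA0 hB0 ⊢
  rw [hA] at hA0 ⊢
  rw [hB] at hB0 ⊢
  have e1 := h1 i k
  have e2 := h2 i k
  have s1 : p ^ (-(n - i) * i) = (p ^ ((n - i) * i))⁻¹ := by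
    rw [← zpow_neg]; congr 1; ring
  have s2 : p ^ (-(i * (i - 1) / 2) + k * (k - 1) / 2) =
      (p ^ (i * (i - 1) / 2 - k * (k - 1) / 2))⁻¹ := by
    rw [← zpow_neg]; congr 1; ring
  have s3 : (-a) ^ (n - k) = (-1) ^ (n - i) * a ^ (n - i) * (-a) ^ (i - k) := by
    rw [← mul_zpow, neg_one_mul, ← zpow_add₀ (neg_ne_zero.mpr ha)]; congr 1; ring
  rw [s1, s2, s3]
  have hA1 := left_ne_zero_of_mul hA0
  have hA2 := right_ne_zero_of_mul hA0
  have hB1 := left_ne_zero_of_mul hB0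
  have hB2 := right_ne_zero_of_mul hB0
  have u1 := left_ne_zero_of_mul hA1
  have u2 := right_ne_zero_of_mul hA1
  have u3 := left_ne_zero_of_mul hB1
  have u4 := right_ne_zero_of_mul hB1
  generalize qPoch p p (n - i).toNat * qPoch (b * p ^ (-n - i) / a) p (n - i).toNat = D1 at *
  generalize qPoch p p (i - k).toNat * qPoch (b * p ^ (1 - 2 * i) / a) p (i - k).toNat = D2 at *
  generalize qPoch (a * p ^ i * q ^ i) q (n - i).toNat *
    qPoch (b * p ^ (-i) * q ^ i) q (n - i).toNat = N1 at *
  generalize qPoch (a * p ^ i * q ^ k) q (i - k).toNat *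
    qPoch (b * q ^ k * p ^ (-i)) q (i - k).toNat = N2 at *
  generalize Polynomial.eval (a * p ^ i + b * p ^ (-i)) (gasperPoly q a b k n) = E at *
  generalize a ^ (n - i) = A1 at *
  generalize (-a) ^ (i - k) = A2 at *
  generalize p ^ ((n - i) * i) = P1 at *
  generalize p ^ (i * (i - 1) / 2 - k * (k - 1) / 2) = P2 at *
  generalize 1 - a * p ^ i * q ^ k = W1 at *
  generalize 1 - b * p ^ (-i) * q ^ k = W2 at *
  generalize (-1 : ℂ) ^ (n - i) = S at *
  generalize 1 - a * p ^ k * q ^ k = V1 at *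
  generalize 1 - b * p ^ (-k) * q ^ k = V2 at *
  clear hA hB hev s1 s2 s3 hA0 hB0 hA1 hB1
  field_simp
  linear_combination (S * V1 * V2) * hN
end

section
/- Let a, b, c, q ∈ ℂ with q ≠ 0, b ≠ 0, b ≠ 1; assume q^j ≠ 1 for every nonzero integer j, c ≠ a·(a + b q^k) for every integer k, c ≠ (a + b q^i)(a + b q^j) for all integers i ≠ j, and c ≠ (a + b q^n)(a + q^n) for every integer n. For integers k ≤ n define F(n,k) = (1/b; q)_{n−k} · ( (a + b q^k) q^k / (c − a(a + b q^k)); q )_{n−k} / [ (q; q)_{n−k} · ( (a + b q^k) b q^{k+1} / (c − a(a + b q^k)); q )_{n−k} ] and G(n,k) = λ(n,k) · (q^{k−n+1}/b; q)_{n−k} · ( (a + b q^n) q^{k+1} / (c − a(a + b q^n)); q )_{n−k} / [ (q; q)_{n−k} · ( (a + b q^n) b q^{k} / (c − a(a + b q^n)); q )_{n−k} ], where λ(n,k) = (−1)^{n−k} · q^{(n−k)(n−k−1)/2} · ( c − (a + b q^k)(a + q^k) ) / ( c − (a + b q^n)(a + q^n) ). Then for all integers k ≤ n, ∑_{i=k}^{n}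 F(n,i)·G(i,k) equals 1 if n = k and equals 0 if n > k. -/
/-- The antisymmetric kernel. -/
noncomputable def fK (c X Y : ℂ) : ℂ := (Y - X) * (c - X * Y)

lemma fK_plucker (c x y t s : ℂ) :
    fK c x y * fK c t s = - fK c x t * fK c s y + fK c x s * fK c t y := by
  unfold fK; ring

lemma fK_sum_zero (c : ℂ) (x y : ℤ → ℂ) (hy : ∀ i j, i ≠ j → fK c (y i) (y j) ≠ 0) (S : Finset ℤ) :
    ∀ T : Finset ℤ, T.card = S.card + 2 →
      ∑ i ∈ T, (∏ j ∈ S, fK c (x j) (y i)) / (∏ j ∈ T.erase i, fK c (y j) (y i)) = 0 := by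
  induction S using Finset.induction_on with
  | empty =>
    intro T hT
    obtain ⟨s, t, hst, rfl⟩ := Finset.card_eq_two.mp (by simpa using hT)
    have h1 : ({s, t} : Finset ℤ).erase s = {t} := by
      ext z; simp only [Finset.mem_erase, Finset.mem_insert, Finset.mem_singleton]; grind
    have h2 : ({s, t} : Finset ℤ).erase t = {s} := by
      ext z; simp only [Finset.mem_erase, Finset.mem_insert, Finset.mem_singleton]; grind
    rw [Finset.sum_pair hst, h1, h2]
    simp only [Finset.prod_empty, Finset.prod_singleton]
    have h3 : fK c (y t) (y s) = - fK c (y s) (y t) := by unfold fK; ring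
    have := hy s t hst
    rw [h3]; field_simp; ring
  | insert r S hr ih =>
    intro T hT
    rw [Finset.card_insert_of_notMem hr] at hT
    obtain ⟨t, ht, s, hs, hts⟩ := Finset.one_lt_card.mp (show 1 < T.card by omega)
    have key : ∀ u ∈ T, ∑ i ∈ T, fK c (y u) (y i) *
        ((∏ j ∈ S, fK c (x j) (y i)) / (∏ j ∈ T.erase i, fK c (y j) (y i))) = 0 := by
      intro u hu
      rw [← Finset.add_sum_erase T _ hu]
      have h0 : fK c (y u) (y u) = 0 := by unfold fK; ring
      rw [h0, zero_mul, zero_add]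
      rw [← ih (T.erase u) (by rw [Finset.card_erase_of_mem hu]; omega)]
      refine Finset.sum_congr rfl fun i hi => ?_
      have hiu : u ≠ i := (Finset.ne_of_mem_erase hi).symm
      have hm : u ∈ T.erase i := Finset.mem_erase.mpr ⟨hiu, hu⟩
      rw [← Finset.mul_prod_erase _ _ hm, Finset.erase_right_comm]
      have := hy u i hiu
      rw [mul_div_assoc', mul_div_mul_left _ _ this]
    have h1 := key t ht
    have h2 := key s hs
    have hne := hy t s hts
    have : fK c (y t) (y s) * ∑ i ∈ T, (∏ j ∈ insert r S, fK c (x j) (y i)) /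
        (∏ j ∈ T.erase i, fK c (y j) (y i)) = 0 := by
      have e : fK c (y t) (y s) * ∑ i ∈ T, (∏ j ∈ insert r S, fK c (x j) (y i)) /
        (∏ j ∈ T.erase i, fK c (y j) (y i)) =
        - fK c (x r) (y t) * (∑ i ∈ T, fK c (y s) (y i) *
        ((∏ j ∈ S, fK c (x j) (y i)) / (∏ j ∈ T.erase i, fK c (y j) (y i)))) +
        fK c (x r) (y s) * (∑ i ∈ T, fK c (y t) (y i) *
        ((∏ j ∈ S, fK c (x j) (y i)) / (∏ j ∈ T.erase i, fK c (y j) (y i)))) := by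
        rw [Finset.mul_sum, Finset.mul_sum, Finset.mul_sum, ← Finset.sum_add_distrib]
        refine Finset.sum_congr rfl fun i hi => ?_
        rw [Finset.prod_insert hr]
        have := fK_plucker c (x r) (y i) (y t) (y s)
        rw [← mul_assoc, ← mul_assoc, ← add_mul, ← this]; ring
      rw [e, h1, h2]; ring
    exact (mul_eq_zero.mp this).resolve_left hne

lemma prod_Ico_int (g : ℤ → ℂ) (k : ℤ) (m : ℕ) :
    ∏ j ∈ Finset.Ico k (k + m), g j = ∏ l ∈ Finset.range m, g (k + l) := by
  induction m with
  | zero => simp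
  | succ m ih =>
    rw [Finset.prod_range_succ, ← ih]
    have : Finset.Ico k (k + ((m + 1 : ℕ) : ℤ)) = insert (k + (m : ℤ)) (Finset.Ico k (k + m)) := by
      ext z; simp only [Finset.mem_Ico, Finset.mem_insert]; push_cast; omega
    rw [this, Finset.prod_insert (by simp), mul_comm]

lemma qPoch_q_rev (q : ℂ) (hq : q ≠ 0) (m : ℕ) :
    qPoch q q m = (-1) ^ (m : ℤ) * q ^ ((m : ℤ) * ((m : ℤ) - 1) / 2) * q ^ (m : ℤ) *
      ∏ l ∈ Finset.range m, (1 - q ^ ((l : ℤ) - m)) := by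
  induction m with
  | zero => simp [qPoch]
  | succ m ih =>
    unfold qPoch at ih ⊢
    rw [Finset.prod_range_succ, ih, Finset.prod_range_succ']
    have e1 : ((m + 1 : ℕ) : ℤ) * (((m + 1 : ℕ) : ℤ) - 1) / 2 = (m : ℤ) * ((m : ℤ) - 1) / 2 + m := by
      rw [← Int.add_mul_ediv_right _ _ (by norm_num : (2 : ℤ) ≠ 0)]
      congr 1; push_cast; ring
    have e2 : ∀ l : ℕ, ((l + 1 : ℕ) : ℤ) - ((m + 1 : ℕ) : ℤ) = (l : ℤ) - m := by
      intro l; push_cast; ring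
    have e3 : ((0 : ℕ) : ℤ) - ((m + 1 : ℕ) : ℤ) = -(((m + 1 : ℕ) : ℤ)) := by simp
    simp only [e2]
    rw [e1, e3, zpow_add₀ hq, zpow_neg]
    simp only [zpow_natCast, pow_succ]
    field_simp
    ring

lemma F_eq (a b c q : ℂ) (hq : q ≠ 0) (hb : b ≠ 0)
    (hc1 : ∀ k : ℤ, c ≠ a * (a + b * q ^ k)) (i n : ℤ) (hin : i ≤ n) :
    (qPoch (1 / b) q (n - i).toNat *
            qPoch ((a + b * q ^ i) * q ^ i / (c - a * (a + b * q ^ i))) q (n - i).toNat) /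
          (qPoch q q (n - i).toNat *
            qPoch ((a + b * q ^ i) * b * q ^ (i + 1) / (c - a * (a + b * q ^ i))) q
              (n - i).toNat) =
    (∏ j ∈ Finset.Ico i n, fK c (a + q ^ j) (a + b * q ^ i)) /
      ∏ j ∈ Finset.Ico (i + 1) (n + 1), fK c (a + b * q ^ j) (a + b * q ^ i) := by
  obtain ⟨m, rfl⟩ := Int.le.dest hin
  have h : (i + (m : ℤ) - i).toNat = m := by simp
  rw [h, show i + (m : ℤ) + 1 = (i + 1) + m by ring, prod_Ico_int, prod_Ico_int]
  unfold qPoch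
  rw [← Finset.prod_mul_distrib, ← Finset.prod_mul_distrib, ← Finset.prod_div_distrib,
    ← Finset.prod_div_distrib]
  refine Finset.prod_congr rfl fun l _ => ?_
  have hD : c - a * (a + b * q ^ i) ≠ 0 := sub_ne_zero.mpr (hc1 i)
  have hqi : q ^ i ≠ 0 := zpow_ne_zero _ hq
  have E1 : fK c (a + q ^ (i + (l : ℤ))) (a + b * q ^ i) =
      (b * q ^ i * (c - a * (a + b * q ^ i))) * ((1 - 1 / b * q ^ l) *
      (1 - (a + b * q ^ i) * q ^ i / (c - a * (a + b * q ^ i)) * q ^ l)) := by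
    unfold fK
    rw [zpow_add₀ hq, zpow_natCast]
    generalize q ^ i = u at *
    field_simp
    ring
  have E2 : fK c (a + b * q ^ (i + 1 + (l : ℤ))) (a + b * q ^ i) =
      (b * q ^ i * (c - a * (a + b * q ^ i))) * ((1 - q * q ^ l) *
      (1 - (a + b * q ^ i) * b * q ^ (i + 1) / (c - a * (a + b * q ^ i)) * q ^ l)) := by
    unfold fK
    rw [zpow_add₀ hq, zpow_add₀ hq, zpow_natCast, zpow_one]
    generalize q ^ i = u at *
    field_simp
    ring
  rw [E1, E2, mul_div_mul_left _ _ (by positivity)]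

lemma G_eq (a b c q : ℂ) (hq : q ≠ 0) (hb : b ≠ 0) (hb1 : b ≠ 1)
    (hq1 : ∀ j : ℤ, j ≠ 0 → q ^ j ≠ 1)
    (hc1 : ∀ k : ℤ, c ≠ a * (a + b * q ^ k)) (k i : ℤ) (hin : k ≤ i) :
    (((-1 : ℂ) ^ (i - k) * q ^ ((i - k) * (i - k - 1) / 2) *
            ((c - (a + b * q ^ k) * (a + q ^ k)) / (c - (a + b * q ^ i) * (a + q ^ i)))) *
          ((qPoch (q ^ (k - i + 1) / b) q (i - k).toNat *
              qPoch ((a + b * q ^ i) * q ^ (k + 1) / (c - a * (a + b * q ^ i))) q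
                (i - k).toNat) /
            (qPoch q q (i - k).toNat *
              qPoch ((a + b * q ^ i) * b * q ^ k / (c - a * (a + b * q ^ i))) q
                (i - k).toNat))) =
    fK c (a + q ^ k) (a + b * q ^ k) / fK c (a + q ^ i) (a + b * q ^ i) *
    ((∏ j ∈ Finset.Ico (k + 1) (i + 1), fK c (a + q ^ j) (a + b * q ^ i)) /
      ∏ j ∈ Finset.Ico k i, fK c (a + b * q ^ j) (a + b * q ^ i)) := by
  obtain ⟨m, hm⟩ := Int.le.dest hin
  have h : (i - k).toNat = m := by omega
  have h' : i - k = (m : ℤ) := by omega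
  rw [h, h', qPoch_q_rev q hq m]
  have P : (∏ j ∈ Finset.Ico (k + 1) (i + 1), fK c (a + q ^ j) (a + b * q ^ i)) /
      ∏ j ∈ Finset.Ico k i, fK c (a + b * q ^ j) (a + b * q ^ i) =
      (qPoch (q ^ (k - i + 1) / b) q m *
        qPoch ((a + b * q ^ i) * q ^ (k + 1) / (c - a * (a + b * q ^ i))) q m) /
      ((∏ l ∈ Finset.range m, (1 - q ^ ((l : ℤ) - m))) *
        qPoch ((a + b * q ^ i) * b * q ^ k / (c - a * (a + b * q ^ i))) q m) := by
    have e1 : Finset.Ico (k + 1) (i + 1) = Finset.Ico (k + 1) (k + 1 + m) := by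
      rw [← hm]; congr 1; ring
    have e2 : Finset.Ico k i = Finset.Ico k (k + m) := by rw [hm]
    rw [e1, e2, prod_Ico_int, prod_Ico_int]
    unfold qPoch
    rw [← Finset.prod_mul_distrib, ← Finset.prod_mul_distrib, ← Finset.prod_div_distrib,
      ← Finset.prod_div_distrib]
    refine Finset.prod_congr rfl fun l _ => ?_
    have hD : c - a * (a + b * q ^ i) ≠ 0 := sub_ne_zero.mpr (hc1 i)
    have hqi : q ^ i ≠ 0 := zpow_ne_zero _ hq
    have hqk : q ^ k ≠ 0 := zpow_ne_zero _ hq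
    have E1 : fK c (a + q ^ (k + 1 + (l : ℤ))) (a + b * q ^ i) =
        (b * q ^ i * (c - a * (a + b * q ^ i))) * ((1 - q ^ (k - i + 1) / b * q ^ l) *
        (1 - (a + b * q ^ i) * q ^ (k + 1) / (c - a * (a + b * q ^ i)) * q ^ l)) := by
      unfold fK
      rw [zpow_add₀ hq, zpow_add₀ hq, zpow_add₀ hq, zpow_sub₀ hq, zpow_natCast, zpow_one]
      generalize q ^ i = u at *
      generalize q ^ k = v at *
      field_simp
      ring
    have E2 : fK c (a + b * q ^ (k + (l : ℤ))) (a + b * q ^ i) =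
        (b * q ^ i * (c - a * (a + b * q ^ i))) * ((1 - q ^ ((l : ℤ) - m)) *
        (1 - (a + b * q ^ i) * b * q ^ k / (c - a * (a + b * q ^ i)) * q ^ l)) := by
      unfold fK
      rw [show (l : ℤ) - m = k + l - i by omega, zpow_sub₀ hq, zpow_add₀ hq, zpow_natCast]
      generalize q ^ i = u at *
      generalize q ^ k = v at *
      field_simp
      ring
    rw [E1, E2, mul_div_mul_left _ _ (by positivity)]
  rw [P]
  have hb1' : b - 1 ≠ 0 := sub_ne_zero.mpr hb1
  have Q : ∀ j : ℤ, fK c (a + q ^ j) (a + b * q ^ j) =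
      (b - 1) * q ^ j * (c - (a + b * q ^ j) * (a + q ^ j)) := by
    intro j; unfold fK; ring
  have hqk : q ^ k ≠ 0 := zpow_ne_zero _ hq
  have hqm : q ^ (m : ℤ) ≠ 0 := zpow_ne_zero _ hq
  have hA : q ^ ((m : ℤ) * ((m : ℤ) - 1) / 2) ≠ 0 := zpow_ne_zero _ hq
  have hB : (-1 : ℂ) ^ (m : ℤ) ≠ 0 := zpow_ne_zero _ (by norm_num)
  have R : fK c (a + q ^ k) (a + b * q ^ k) / fK c (a + q ^ i) (a + b * q ^ i) =
      (c - (a + b * q ^ k) * (a + q ^ k)) / (c - (a + b * q ^ i) * (a + q ^ i)) / q ^ (m : ℤ) := by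
    rw [Q, Q]
    generalize (c - (a + b * q ^ k) * (a + q ^ k)) = U
    generalize (c - (a + b * q ^ i) * (a + q ^ i)) = V
    rw [← hm, zpow_add₀ hq, div_div, mul_assoc (b - 1), mul_assoc (b - 1),
      mul_div_mul_left _ _ hb1', mul_assoc (q ^ k), mul_div_mul_left _ _ hqk, mul_comm V]
  rw [R]
  generalize q ^ (m : ℤ) = z1 at *
  generalize q ^ ((m : ℤ) * ((m : ℤ) - 1) / 2) = z2 at *
  generalize (-1 : ℂ) ^ (m : ℤ) = z3 at *
  simp only [div_eq_mul_inv, mul_inv]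
  field_simp

/-- Schlosser's matrix inversion (Example 4.2 of Wang–Ma). -/
theorem schlosser_matrix_inversion
    (a b c q : ℂ)
    (hq : q ≠ 0) (hb : b ≠ 0) (hb1 : b ≠ 1)
    (hq1 : ∀ j : ℤ, j ≠ 0 → q ^ j ≠ 1)
    (hc1 : ∀ k : ℤ, c ≠ a * (a + b * q ^ k))
    (hc2 : ∀ i j : ℤ, i ≠ j → c ≠ (a + b * q ^ i) * (a + b * q ^ j))
    (hc3 : ∀ n : ℤ, c ≠ (a + b * q ^ n) * (a + q ^ n)) :
    ∀ k n : ℤ, k ≤ n →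
      (∑ i ∈ Finset.Icc k n,
        -- F(n,i)
        ((qPoch (1 / b) q (n - i).toNat *
            qPoch ((a + b * q ^ i) * q ^ i / (c - a * (a + b * q ^ i))) q (n - i).toNat) /
          (qPoch q q (n - i).toNat *
            qPoch ((a + b * q ^ i) * b * q ^ (i + 1) / (c - a * (a + b * q ^ i))) q
              (n - i).toNat)) *
        -- G(i,k)
        (((-1 : ℂ) ^ (i - k) * q ^ ((i - k) * (i - k - 1) / 2) *
            ((c - (a + b * q ^ k) * (a + q ^ k)) / (c - (a + b * q ^ i) * (a + q ^ i)))) *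
          ((qPoch (q ^ (k - i + 1) / b) q (i - k).toNat *
              qPoch ((a + b * q ^ i) * q ^ (k + 1) / (c - a * (a + b * q ^ i))) q
                (i - k).toNat) /
            (qPoch q q (i - k).toNat *
              qPoch ((a + b * q ^ i) * b * q ^ k / (c - a * (a + b * q ^ i))) q
                (i - k).toNat)))) =
      if n = k then 1 else 0 := by
  intro k n hkn
  have hy : ∀ i j : ℤ, i ≠ j → fK c (a + b * q ^ i) (a + b * q ^ j) ≠ 0 := by
    intro i j hij
    unfold fK
    refine mul_ne_zero ?_ (sub_ne_zero.mpr (hc2 i j hij))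
    intro h
    apply hq1 (j - i) (by omega)
    have : b * (q ^ j - q ^ i) = 0 := by linear_combination h
    have h2 := (mul_eq_zero.mp this).resolve_left hb
    rw [zpow_sub₀ hq, div_eq_one_iff_eq (zpow_ne_zero _ hq)]
    exact sub_eq_zero.mp h2
  have hd : ∀ i : ℤ, fK c (a + q ^ i) (a + b * q ^ i) ≠ 0 := by
    intro i
    have : fK c (a + q ^ i) (a + b * q ^ i) =
      (b - 1) * q ^ i * (c - (a + b * q ^ i) * (a + q ^ i)) := by unfold fK; ring
    rw [this]
    exact mul_ne_zero (mul_ne_zero (sub_ne_zero.mpr hb1) (zpow_ne_zero _ hq))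
      (sub_ne_zero.mpr (hc3 i))
  rcases eq_or_lt_of_le hkn with rfl | hlt
  · rw [Finset.Icc_self, Finset.sum_singleton, F_eq a b c q hq hb hc1 _ _ le_rfl,
      G_eq a b c q hq hb hb1 hq1 hc1 _ _ le_rfl]
    simp [hd k]
  · rw [if_neg hlt.ne']
    have hz := fK_sum_zero c (fun j => a + q ^ j) (fun j => a + b * q ^ j) hy
      (Finset.Ico (k + 1) n) (Finset.Icc k n) (by simp only [Int.card_Icc, Int.card_Ico]; omega)
    have : ∀ i ∈ Finset.Icc k n, _ = _ := fun i hi => by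
      have hi' := Finset.mem_Icc.mp hi
      exact congrArg₂ (· * ·) (F_eq a b c q hq hb hc1 i n hi'.2)
        (G_eq a b c q hq hb hb1 hq1 hc1 k i hi'.1)
    refine (Finset.sum_congr rfl this).trans ?_
    rw [← mul_zero (fK c (a + q ^ k) (a + b * q ^ k)), ← hz, Finset.mul_sum]
    refine Finset.sum_congr rfl fun i hi => ?_
    have hi' := Finset.mem_Icc.mp hi
    have hden : ∏ j ∈ (Finset.Icc k n).erase i, fK c (a + b * q ^ j) (a + b * q ^ i) =
        (∏ j ∈ Finset.Ico (i + 1) (n + 1), fK c (a + b * q ^ j) (a + b * q ^ i)) *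
        ∏ j ∈ Finset.Ico k i, fK c (a + b * q ^ j) (a + b * q ^ i) := by
      rw [← Finset.prod_union]
      · congr 1; ext z
        simp only [Finset.mem_erase, Finset.mem_Icc, Finset.mem_union, Finset.mem_Ico]; omega
      · rw [Finset.disjoint_left]; intro z
        simp only [Finset.mem_Ico]; omega
    have hnum : (∏ j ∈ Finset.Ico i n, fK c (a + q ^ j) (a + b * q ^ i)) *
        (∏ j ∈ Finset.Ico (k + 1) (i + 1), fK c (a + q ^ j) (a + b * q ^ i)) =
        fK c (a + q ^ i) (a + b * q ^ i) *
          ∏ j ∈ Finset.Ico (k + 1) n, fK c (a + q ^ j) (a + b * q ^ i) := by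
      rcases eq_or_lt_of_le hi'.1 with rfl | hki
      · rw [Finset.Ico_self, Finset.prod_empty, mul_one]
        have : Finset.Ico k n = insert k (Finset.Ico (k + 1) n) := by
          ext z; simp only [Finset.mem_insert, Finset.mem_Ico]; omega
        rw [this, Finset.prod_insert (by simp)]
      · have e1 : Finset.Ico (k + 1) (i + 1) = insert i (Finset.Ico (k + 1) i) := by
          ext z; simp only [Finset.mem_insert, Finset.mem_Ico]; omega
        have e2 : Finset.Ico (k + 1) n = Finset.Ico i n ∪ Finset.Ico (k + 1) i := by
          ext z; simp only [Finset.mem_union, Finset.mem_Ico]; omega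
        rw [e1, Finset.prod_insert (by simp), e2, Finset.prod_union]
        · ring
        · rw [Finset.disjoint_left]; intro z
          simp only [Finset.mem_Ico]; omega
    have hdi := hd i
    simp only [hden]
    have step : ∀ A B C D E H : ℂ, A / B * (E / H * (C / D)) = E * (A * C / H) / (B * D) := by
      intros; simp only [div_eq_mul_inv, mul_inv]; ring
    rw [step, hnum, mul_div_cancel_left₀ _ hdi, mul_div_assoc]
end
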